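/- arXiv:1904.05262 — 5 statements merged into one kernel-verified Lean document; each statement's English description precedes it below -/
import Mathlib

section
/- For all m, n, m′, n′ ∈ ℤ ∖ {0}, the endomorphisms d_{m,n} = E_{m,−n} + sign(m)·sign(n)·E_{n,−m} satisfy the commutation relation [d_{m,n}, d_{m′,n′}] = δ_{n+m′,0}·d_{m,n′} + δ_{m+m′,0}·sign(m)·sign(n)·d_{n,n′} + δ_{n+n′,0}·sign(m′)·sign(n′)·d_{m,m′} + δ_{m+n′,0}·sign(m)·sign(n)·sign(m′)·sign(n′)·d_{n,m′}, where δ is the Kronecker delta. -/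
/-!
Statement 0: commutation relations of the elements `d_{m,n} = E_{m,-n} + sign(m)·sign(n)·E_{n,-m}`
in the endomorphism algebra of the free ℚ-module `F` with basis indexed by `ℤ ∖ {0}`.
-/

noncomputable section

/-- The free ℚ-module with basis indexed by the nonzero integers. -/
abbrev FreeMod : Type := {k : ℤ // k ≠ 0} →₀ ℚ

/-- The elementary endomorphism `E_{a,b}`, sending the basis vector `u_b` to `u_a`
and all other basis vectors to `0`. -/
def Eel (a b : {k : ℤ // k ≠ 0}) : Module.End ℚ FreeMod :=
  (Finsupp.lsingle a).comp (Finsupp.lapply b)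

/-- `sign m = 1` if `m > 0` and `-1` if `m < 0` (as a rational number). -/
def isign (m : ℤ) : ℚ := if 0 < m then 1 else -1

/-- The element `d_{m,n} = E_{m,-n} + sign(m)·sign(n)·E_{n,-m}`. -/
def del (m n : ℤ) (hm : m ≠ 0) (hn : n ≠ 0) : Module.End ℚ FreeMod :=
  Eel ⟨m, hm⟩ ⟨-n, neg_ne_zero.mpr hn⟩ +
    (isign m * isign n) • Eel ⟨n, hn⟩ ⟨-m, neg_ne_zero.mpr hm⟩

theorem Eel_mul_Eel (a b c d : {k : ℤ // k ≠ 0}) :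
    Eel a b * Eel c d = (if (b : ℤ) = c then (1 : ℚ) else 0) • Eel a d := by
  ext x y
  by_cases h : b = c
  · simp [Eel, h]
  · have h' : (b : ℤ) ≠ c := fun e => h (Subtype.ext e)
    simp [Eel, h', Finsupp.single_eq_of_ne h]

theorem isign_mul_self (m : ℤ) : isign m * isign m = 1 := by
  unfold isign
  split_ifs <;> norm_num

theorem isign_add_isign {m n : ℤ} (hm : m ≠ 0) (h : m + n = 0) : isign m + isign n = 0 := by
  obtain rfl : n = -m := by omega
  unfold isign
  split_ifs <;> first | omega | norm_num

theorem ite_mul_isign_add_isign {m n : ℤ} (hm : m ≠ 0) :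
    (if m + n = 0 then (1 : ℚ) else 0) * (isign m + isign n) = 0 := by
  split_ifs with h
  · rw [isign_add_isign hm h, mul_zero]
  · exact zero_mul _

theorem stmt0 (m n m' n' : ℤ) (hm : m ≠ 0) (hn : n ≠ 0) (hm' : m' ≠ 0) (hn' : n' ≠ 0) :
    ⁅del m n hm hn, del m' n' hm' hn'⁆ =
      (if n + m' = 0 then (1 : ℚ) else 0) • del m n' hm hn' +
      (if m + m' = 0 then isign m * isign n else 0) • del n n' hn hn' +
      (if n + n' = 0 then isign m' * isign n' else 0) • del m m' hm hm' +
      (if m + n' = 0 then isign m * isign n * isign m' * isign n' else 0) •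
        del n m' hn hm' := by
  have ite_eq (p : Prop) [Decidable p] (q : ℚ) :
      (if p then q else 0) = (if p then 1 else 0) * q := by split_ifs <;> simp
  have e₁ : -n = m' ↔ n + m' = 0 := by omega
  have e₂ : -m = m' ↔ m + m' = 0 := by omega
  have e₃ : -n = n' ↔ n + n' = 0 := by omega
  have e₄ : -m = n' ↔ m + n' = 0 := by omega
  have f₁ : -m' = n ↔ n + m' = 0 := by omega
  have f₂ : -m' = m ↔ m + m' = 0 := by omega
  have f₃ : -n' = n ↔ n + n' = 0 := by omega
  have f₄ : -n' = m ↔ m + n' = 0 := by omega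
  have h₁ := ite_mul_isign_add_isign (n := m') hn
  have h₂ := ite_mul_isign_add_isign (n := m') hm
  have h₃ := ite_mul_isign_add_isign (n := n') hn
  have h₄ := ite_mul_isign_add_isign (n := n') hm
  have sm := isign_mul_self m
  have sn := isign_mul_self n
  have sm' := isign_mul_self m'
  have sn' := isign_mul_self n'
  rw [ite_eq (m + m' = 0) (isign m * isign n), ite_eq (n + n' = 0) (isign m' * isign n'),
    ite_eq (m + n' = 0) (isign m * isign n * isign m' * isign n'), Ring.lie_def]
  simp only [del, mul_add, add_mul, smul_mul_assoc, mul_smul_comm, Eel_mul_Eel,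
    e₁, e₂, e₃, e₄, f₁, f₂, f₃, f₄]
  generalize (if n + m' = 0 then (1 : ℚ) else 0) = δ₁ at *
  generalize (if m + m' = 0 then (1 : ℚ) else 0) = δ₂ at *
  generalize (if n + n' = 0 then (1 : ℚ) else 0) = δ₃ at *
  generalize (if m + n' = 0 then (1 : ℚ) else 0) = δ₄ at *
  generalize isign m = a at *
  generalize isign n = b at *
  generalize isign m' = c at *
  generalize isign n' = d at *
  match_scalars <;> grind

end
end

section
/- For all m, n, m′, n′ ∈ ℤ ∖ {0}, the operators D_{m,n} satisfy the sp_{2∞} commutation relations: [D_{m,n}, D_{m′,n′}] = δ_{n+m′,0}·D_{m,n′} + δ_{m+m′,0}·sign(m)·sign(n)·D_{n,n′} + δ_{n+n′,0}·sign(m′)·sign(n′)·D_{m,m′} + δ_{m+n′,0}·sign(m)·sign(n)·sign(m′)·sign(n′)·D_{n,m′}. -/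
/-!
Statement 4: the renormalized operators
`D_{m,n} = (sign(n)/√|mn|)·Q_{m,n} + δ_{m+n,0}·(b/2)·id` satisfy the `sp_{2∞}`
commutation relations.
-/

noncomputable section

/-- `sign m = 1` if `m > 0` and `-1` if `m < 0` (as a real number). -/
def rsign (m : ℤ) : ℝ := if 0 < m then 1 else -1

/-- `Q_{m,n} = Σ_{i=1}^b q^i_m ∘ q^i_n`. -/
def Qop {V : Type*} [AddCommGroup V] [Module ℝ V]
    (b : ℕ) (q : Fin b → ℤ → Module.End ℝ V) (m n : ℤ) : Module.End ℝ V :=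
  ∑ i, q i m * q i n

/-- `D_{m,n} = (sign(n)/√|m·n|)·Q_{m,n} + δ_{m+n,0}·(b/2)·id`. -/
def Dop {V : Type*} [AddCommGroup V] [Module ℝ V]
    (b : ℕ) (q : Fin b → ℤ → Module.End ℝ V) (m n : ℤ) : Module.End ℝ V :=
  (rsign n / Real.sqrt |((m * n : ℤ) : ℝ)|) • Qop b q m n +
    (if m + n = 0 then (b : ℝ) / 2 else 0) • 1

/-- A bracket of quadratic products, expanded in terms of scalar commutators. -/
theorem lie_mul_mul_of_lie_eq_smul_one {A : Type*} [Ring A] [Algebra ℝ A] {w x y z : A}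
    {a c d e : ℝ} (hxy : ⁅x, y⁆ = a • (1 : A)) (hxz : ⁅x, z⁆ = c • (1 : A))
    (hwy : ⁅w, y⁆ = d • (1 : A)) (hwz : ⁅w, z⁆ = e • (1 : A)) :
    ⁅w * x, y * z⁆ = a • (w * z) + c • (w * y) + d • (z * x) + e • (y * x) := by
  have h : ⁅w * x, y * z⁆ =
      w * ⁅x, y⁆ * z + w * y * ⁅x, z⁆ + ⁅w, y⁆ * z * x + y * ⁅w, z⁆ * x := by
    simp only [Ring.lie_def]
    noncomm_ring
  rw [h, hxy, hxz, hwy, hwz]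
  simp

theorem smul_add_smul_one_lie {A : Type*} [Ring A] [Algebra ℝ A] (a c d f : ℝ) (x y : A) :
    ⁅a • x + c • (1 : A), d • y + f • (1 : A)⁆ = (a * d) • ⁅x, y⁆ := by
  simp only [Ring.lie_def, mul_add, add_mul, smul_mul_assoc, mul_smul_comm, mul_one, one_mul]
  module

section Qop

variable {V : Type*} [AddCommGroup V] [Module ℝ V] {b : ℕ} {p : Fin b → ℤ → Module.End ℝ V}
  {e : ℤ → ℤ → ℝ}

theorem Qop_swap {m n : ℤ} (h : ∀ i, ⁅p i m, p i n⁆ = e m n • (1 : Module.End ℝ V)) :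
    Qop b p m n = Qop b p n m + ((b : ℝ) * e m n) • 1 := by
  have h' : ∀ i, p i m * p i n = p i n * p i m + e m n • 1 := fun i => by
    rw [← h i, Ring.lie_def]
    abel
  simp only [Qop, h', Finset.sum_add_distrib, Finset.sum_const, Finset.card_univ,
    Fintype.card_fin, mul_smul, Nat.cast_smul_eq_nsmul]

theorem lie_Qop_Qop {m n m' n' : ℤ}
    (h : ∀ i j : Fin b, ∀ k ∈ ({m, n} : Set ℤ), ∀ l ∈ ({m', n'} : Set ℤ),
      ⁅p i k, p j l⁆ = (e k l * if i = j then 1 else 0) • (1 : Module.End ℝ V)) :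
    ⁅Qop b p m n, Qop b p m' n'⁆ =
      e n m' • Qop b p m n' + e n n' • Qop b p m m' + e m m' • Qop b p n' n +
        e m n' • Qop b p m' n := by
  have key : ∀ i j : Fin b, ⁅p i m * p i n, p j m' * p j n'⁆ =
      if i = j then e n m' • (p i m * p i n') + e n n' • (p i m * p i m') +
        e m m' • (p i n' * p i n) + e m n' • (p i m' * p i n) else 0 := fun i j => by
    rw [lie_mul_mul_of_lie_eq_smul_one (h i j n (by simp) m' (by simp))
      (h i j n (by simp) n' (by simp)) (h i j m (by simp) m' (by simp))
      (h i j m (by simp) n' (by simp))]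
    split_ifs with hij
    · subst hij
      simp
    · simp
  simp only [Qop, Ring.lie_def, Finset.sum_mul_sum] at key ⊢
  rw [Finset.sum_comm (f := fun i j => p i m' * p i n' * (p j m * p j n))]
  simp only [← Finset.sum_sub_distrib, key, Finset.sum_ite_eq, Finset.mem_univ, if_true,
    Finset.sum_add_distrib, Finset.smul_sum]

theorem Dop_eq_rsign_smul_Qop (q : Fin b → ℤ → Module.End ℝ V) (m n : ℤ) :
    Dop b q m n = rsign n • Qop b (fun i k => (√|(k : ℝ)|)⁻¹ • q i k) m n +
      (if m + n = 0 then (b : ℝ) / 2 else 0) • 1 := by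
  have h : rsign n / √|((m * n : ℤ) : ℝ)| = rsign n * ((√|(m : ℝ)|)⁻¹ * (√|(n : ℝ)|)⁻¹) := by
    rw [Int.cast_mul, abs_mul, Real.sqrt_mul (abs_nonneg _), div_eq_mul_inv, mul_inv]
  simp only [Dop, Qop, h, smul_mul_smul_comm, ← Finset.smul_sum, mul_smul]

end Qop

theorem rsign_neg {m : ℤ} (hm : m ≠ 0) : rsign (-m) = -rsign m := by
  unfold rsign
  split_ifs <;> first | omega | norm_num

theorem rsign_mul_self (m : ℤ) : rsign m * rsign m = 1 := by
  unfold rsign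
  split_ifs <;> norm_num

theorem inv_sqrt_abs_mul_self {m : ℤ} (hm : m ≠ 0) :
    (√|(m : ℝ)|)⁻¹ * (√|(m : ℝ)|)⁻¹ * m = rsign m := by
  have h : (m : ℝ) ≠ 0 := by exact_mod_cast hm
  rw [← mul_inv, Real.mul_self_sqrt (abs_nonneg _)]
  unfold rsign
  split_ifs with h'
  · rw [abs_of_pos (by exact_mod_cast h'), inv_mul_cancel₀ h]
  · rw [abs_of_nonpos (by exact_mod_cast not_lt.mp h'), inv_neg, neg_mul, inv_mul_cancel₀ h]

theorem stmt4 {V : Type*} [AddCommGroup V] [Module ℝ V]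
    (b : ℕ) (hb : 1 ≤ b) (q : Fin b → ℤ → Module.End ℝ V)
    (hq : ∀ i j : Fin b, ∀ n m : ℤ, n ≠ 0 → m ≠ 0 →
      ⁅q i n, q j m⁆ =
        ((n : ℝ) * (if n + m = 0 then 1 else 0) * (if i = j then 1 else 0)) • 1)
    (m n m' n' : ℤ) (hm : m ≠ 0) (hn : n ≠ 0) (hm' : m' ≠ 0) (hn' : n' ≠ 0) :
    ⁅Dop b q m n, Dop b q m' n'⁆ =
      (if n + m' = 0 then (1 : ℝ) else 0) • Dop b q m n' +
      (if m + m' = 0 then rsign m * rsign n else 0) • Dop b q n n' +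
      (if n + n' = 0 then rsign m' * rsign n' else 0) • Dop b q m m' +
      (if m + n' = 0 then rsign m * rsign n * rsign m' * rsign n' else 0) •
        Dop b q n m' := by
  set p : Fin b → ℤ → Module.End ℝ V := fun i k => (√|(k : ℝ)|)⁻¹ • q i k with hp_def
  let e : ℤ → ℤ → ℝ := fun k l => if k + l = 0 then rsign k else 0
  have hp : ∀ i j : Fin b, ∀ k l : ℤ, k ≠ 0 → l ≠ 0 →
      ⁅p i k, p j l⁆ = (e k l * if i = j then 1 else 0) • (1 : Module.End ℝ V) := by
    intro i j k l hk hl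
    have h := smul_add_smul_one_lie (√|(k : ℝ)|)⁻¹ 0 (√|(l : ℝ)|)⁻¹ 0 (q i k) (q j l)
    simp only [zero_smul, add_zero, hq i j k l hk hl, smul_smul] at h
    simp only [hp_def, h, e]
    congr 1
    by_cases hkl : k + l = 0
    · obtain rfl : l = -k := by omega
      simp only [Int.cast_neg, abs_neg, add_neg_cancel, if_true]
      rw [← inv_sqrt_abs_mul_self hk]
      ring
    · simp [hkl]
  have hS : ⁅Qop b p m n, Qop b p m' n'⁆ = _ := lie_Qop_Qop (e := e) fun i j k hk l hl =>
    hp i j k l (by rcases hk with rfl | rfl <;> assumption)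
      (by rcases hl with rfl | rfl <;> assumption)
  have hswap : ∀ k l : ℤ, k ≠ 0 → l ≠ 0 →
      Qop b p k l = Qop b p l k + ((b : ℝ) * e k l) • 1 := fun k l hk hl =>
    Qop_swap fun i => by simpa using hp i i k l hk hl
  rw [hswap n' n hn' hn, hswap m' n hm' hn] at hS
  simp only [Dop_eq_rsign_smul_Qop, ← hp_def, smul_add_smul_one_lie, hS, e,
    add_comm n' n, add_comm m' n]
  have hneg : ∀ k l : ℤ, k ≠ 0 → k + l = 0 → rsign l = -rsign k := fun k l hk h => by
    rw [← rsign_neg hk, eq_neg_of_add_eq_zero_right h]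
  have h₁ := hneg n m' hn
  have h₂ := hneg m m' hm
  have h₃ := hneg n n' hn
  have h₄ := hneg m n' hm
  have s₁ := rsign_mul_self m
  have s₂ := rsign_mul_self n
  have s₃ := rsign_mul_self m'
  have s₄ := rsign_mul_self n'
  clear hS hswap hp hneg hq
  match_scalars <;> grind

end
end

section
/- The operators L_n satisfy the Virasoro relations with central charge b: for all m, n ∈ ℤ, [L_m, L_n] = (m − n)·L_{m+n} − δ_{m+n,0}·((m³ − m)/12)·b·id_V. -/
/-!
Statement 7: the Virasoro operators `L_n = (1/2)·Σ_i Σ_{a+c=n, a,c≠0} :q^i_a q^i_c:`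
satisfy `[L_m, L_n] = (m-n)·L_{m+n} - δ_{m+n,0}·((m³-m)/12)·b·id`.
The sum defining `L_n` is a `finsum` over `a ∈ ℤ` (with `c = n - a`), which by the
local finiteness assumption has only finitely many nonzero terms on each vector.
-/

noncomputable section

/-- The Virasoro operator `L_n`, applied to a vector `v`:
`L_n v = (1/2)·Σ_{a ∈ ℤ, a ≠ 0, n-a ≠ 0} Σ_i (:q^i_a q^i_{n-a}:)(v)`,
where `:q_a q_c: = q_a ∘ q_c` if `a ≥ c` and `q_c ∘ q_a` otherwise. -/
def Lop {V : Type*} [AddCommGroup V] [Module ℚ V]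
    (b : ℕ) (q : Fin b → ℤ → Module.End ℚ V) (n : ℤ) (v : V) : V :=
  (2⁻¹ : ℚ) • ∑ᶠ a : ℤ,
    if a ≠ 0 ∧ n - a ≠ 0 then
      ∑ i, (if n - a ≤ a then (q i a * q i (n - a)) v else (q i (n - a) * q i a) v)
    else 0

namespace Virasoro

/-- The normal-ordered product `:q_a q_c:`, written as `q_a q_c` minus its central correction. -/
def normalOrdered {V : Type*} [AddCommGroup V] [Module ℚ V] {b : ℕ}
    (q : Fin b → ℤ → Module.End ℚ V) (i : Fin b) (a c : ℤ) : Module.End ℚ V :=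
  q i a * q i c - (if a + c = 0 ∧ a < 0 then (a : ℚ) else 0) • 1

/-- The summand of index `a` in `2 L_n`. -/
def modeTerm {V : Type*} [AddCommGroup V] [Module ℚ V] {b : ℕ}
    (q : Fin b → ℤ → Module.End ℚ V) (n a : ℤ) : Module.End ℚ V :=
  ∑ i, normalOrdered q i a (n - a)

/-- The coefficients whose sum over `a` is the central term of `[L_m, L_{-m}]`, up to scaling. -/
def anomaly (m a : ℤ) : ℚ :=
  (a : ℚ) * ((m : ℚ) + a) * ((if m + a < 0 then 1 else 0) - (if a < 0 then 1 else 0))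

theorem sum_Ico_mul_add (m x : ℤ) (k : ℕ) :
    ∑ a ∈ Finset.Ico x (x + k), (a : ℚ) * ((m : ℚ) + a) =
      (((x + k : ℤ) : ℚ) * ((x + k : ℤ) - 1) * (2 * (x + k : ℤ) - 1) / 6
        + m * ((x + k : ℤ) * ((x + k : ℤ) - 1) / 2))
      - ((x : ℚ) * (x - 1) * (2 * x - 1) / 6 + m * (x * (x - 1) / 2)) := by
  induction k with
  | zero => simp
  | succ k ih =>
    have h : Finset.Ico x (x + (k + 1 : ℕ)) = insert (x + k) (Finset.Ico x (x + k)) := by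
      ext; simp; omega
    rw [h, Finset.sum_insert (by simp), ih]
    push_cast
    ring

theorem support_anomaly_subset (m : ℤ) :
    Function.support (anomaly m) ⊆ (Finset.Ico (-|m|) |m| : Finset ℤ) := by
  intro a ha
  simp only [Finset.coe_Ico, Set.mem_Ico]
  by_contra h
  apply ha
  unfold anomaly
  rcases abs_cases m with ⟨h1, h2⟩ | ⟨h1, h2⟩ <;> rw [h1] at h <;>
    split_ifs <;> first | omega | simp

theorem finsum_anomaly (m : ℤ) : ∑ᶠ a, anomaly m a = ((m : ℚ) ^ 3 - m) / 6 := by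
  rw [finsum_eq_sum_of_support_subset _ (support_anomaly_subset m)]
  have hm := abs_le.mp (le_refl |m|)
  have h (y : ℤ) (h1 : -|m| ≤ y) (h2 : y ≤ |m|) :
      ∑ a ∈ Finset.Ico (-|m|) |m|, (a : ℚ) * ((m : ℚ) + a) * (if a < y then 1 else 0) =
        ∑ a ∈ Finset.Ico (-|m|) (-|m| + (y + |m|).toNat), (a : ℚ) * ((m : ℚ) + a) := by
    simp only [mul_ite, mul_one, mul_zero]
    rw [← Finset.sum_filter]
    congr 1
    ext; simp; omega
  have e : ∀ a : ℤ, (m + a < 0) = (a < -m) := fun a => propext ⟨by omega, by omega⟩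
  simp only [anomaly, mul_sub, Finset.sum_sub_distrib, e]
  rw [h (-m) (by omega) (by omega), h 0 (by omega) (by omega), sum_Ico_mul_add, sum_Ico_mul_add,
    Int.toNat_of_nonneg (by omega), Int.toNat_of_nonneg (by omega)]
  rw [show -|m| + (-m + |m|) = -m by ring, show -|m| + (0 + |m|) = 0 by ring]
  push_cast
  ring

section

variable {V : Type*} [AddCommGroup V] [Module ℚ V] {b : ℕ} {q : Fin b → ℤ → Module.End ℚ V}

theorem mul_apply_eq
    (hc : ∀ i j n m v, q i n (q j m v) - q j m (q i n v) =
      (if n + m = 0 ∧ i = j then (n : ℚ) else 0) • v) (i j : Fin b) (n m : ℤ) (v : V) :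
    q i n (q j m v) = q j m (q i n v) + (if n + m = 0 ∧ i = j then (n : ℚ) else 0) • v := by
  rw [← hc]; abel

theorem commutator_apply
    (hq : ∀ i j : Fin b, ∀ n m : ℤ, n ≠ 0 → m ≠ 0 →
      ⁅q i n, q j m⁆ =
        ((n : ℚ) * (if n + m = 0 then 1 else 0) * (if i = j then 1 else 0)) • 1)
    (hq0 : ∀ i, q i 0 = 0) (i j : Fin b) (n m : ℤ) (v : V) :
    q i n (q j m v) - q j m (q i n v) = (if n + m = 0 ∧ i = j then (n : ℚ) else 0) • v := by
  by_cases hn : n = 0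
  · subst hn; simp [hq0]
  by_cases hm : m = 0
  · subst hm; simp [hq0, hn]
  have := LinearMap.congr_fun (hq i j n m hn hm) v
  simp only [Ring.lie_def, LinearMap.sub_apply, Module.End.mul_apply, LinearMap.smul_apply,
    Module.End.one_apply] at this
  rw [this]
  congr 1
  split_ifs <;> simp_all

theorem summand_eq_modeTerm
    (hc : ∀ i j n m v, q i n (q j m v) - q j m (q i n v) =
      (if n + m = 0 ∧ i = j then (n : ℚ) else 0) • v)
    (hq0 : ∀ i, q i 0 = 0) (n a : ℤ) (v : V) :
    (if a ≠ 0 ∧ n - a ≠ 0 then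
      ∑ i, (if n - a ≤ a then (q i a * q i (n - a)) v else (q i (n - a) * q i a) v)
    else 0) = modeTerm q n a v := by
  simp only [modeTerm, LinearMap.sum_apply]
  by_cases ha : a = 0
  · subst ha; simp [normalOrdered, hq0]
  by_cases ha' : n - a = 0
  · rw [ha']; simp [normalOrdered, hq0, ha]
  rw [if_pos ⟨ha, ha'⟩]
  refine Finset.sum_congr rfl fun i _ => ?_
  simp only [normalOrdered, LinearMap.sub_apply, Module.End.mul_apply, LinearMap.smul_apply,
    Module.End.one_apply]
  split_ifs with h1 h2 h2
  · omega
  · simp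
  · rw [mul_apply_eq hc i i a (n - a), if_pos ⟨h2.1, rfl⟩]; abel
  · rw [mul_apply_eq hc i i a (n - a), if_neg (by omega)]; simp

theorem finite_support_modeTerm
    (hc : ∀ i j n m v, q i n (q j m v) - q j m (q i n v) =
      (if n + m = 0 ∧ i = j then (n : ℚ) else 0) • v)
    (hq0 : ∀ i, q i 0 = 0)
    (hfin : ∀ v : V, ∃ N : ℤ, ∀ n : ℤ, N < n → ∀ i, q i (-n) v = 0) (n : ℤ) (v : V) :
    (Function.support fun a => modeTerm q n a v).Finite := by
  obtain ⟨N, hN⟩ := hfin v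
  have hN' : ∀ k : ℤ, k < -N → ∀ i, q i k v = 0 := fun k hk i => by
    simpa using hN (-k) (by omega) i
  refine (Set.finite_Icc (-N) (n + N)).subset fun a ha => ?_
  by_contra h
  apply ha
  simp only [Set.mem_Icc, not_and_or, not_le] at h
  change modeTerm q n a v = 0
  rw [← summand_eq_modeTerm hc hq0]
  by_cases h0 : a ≠ 0 ∧ n - a ≠ 0
  · rw [if_pos h0]
    refine Finset.sum_eq_zero fun i _ => ?_
    simp only [Module.End.mul_apply]
    split_ifs with h1
    · rw [hN' (n - a) (by omega), map_zero]
    · rw [hN' a (by omega), map_zero]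
  · rw [if_neg h0]

theorem exists_linear
    (hS : ∀ n v, (Function.support fun a => modeTerm q n a v).Finite) :
    ∃ L : ℤ → Module.End ℚ V, ∀ n v, L n v = (2⁻¹ : ℚ) • ∑ᶠ a, modeTerm q n a v := by
  refine ⟨fun n =>
    { toFun := fun v => (2⁻¹ : ℚ) • ∑ᶠ a, modeTerm q n a v
      map_add' := fun v w => ?_
      map_smul' := fun c v => ?_ }, fun n v => rfl⟩
  · simp only [map_add]
    rw [finsum_add_distrib (hS n v) (hS n w), smul_add]
  · simp only [map_smul, RingHom.id_apply]
    rw [← smul_finsum' c (hS n v), smul_comm]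

theorem modeTerm_apply_sub
    (hc : ∀ i j n m v, q i n (q j m v) - q j m (q i n v) =
      (if n + m = 0 ∧ i = j then (n : ℚ) else 0) • v) (n a : ℤ) (j : Fin b) (k : ℤ) (w : V) :
    modeTerm q n a (q j k w) - q j k (modeTerm q n a w) =
      (if a = n + k then (-k : ℚ) • q j (n + k) w else 0) +
      (if a = -k then (-k : ℚ) • q j (n + k) w else 0) := by
  simp only [modeTerm, LinearMap.sum_apply, map_sum, ← Finset.sum_sub_distrib]
  rw [Finset.sum_eq_single j]
  · simp only [normalOrdered, LinearMap.sub_apply, Module.End.mul_apply, LinearMap.smul_apply,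
      Module.End.one_apply, map_sub, map_smul]
    rw [mul_apply_eq hc j j (n - a) k, map_add, mul_apply_eq hc j j a k, map_smul]
    have e1 : (n - a + k = 0) = (a = n + k) := propext ⟨by omega, by omega⟩
    have e2 : (a + k = 0) = (a = -k) := propext ⟨by omega, by omega⟩
    simp only [and_true, e1, e2]
    have f1 : (if a = n + k then ((n - a : ℤ) : ℚ) else 0) • q j a w =
        if a = n + k then (-k : ℚ) • q j (n + k) w else 0 := by
      split_ifs with h
      · subst h; push_cast; congr 1; ring
      · simp
    have f2 : (if a = -k then (a : ℚ) else 0) • q j (n - a) w =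
        if a = -k then (-k : ℚ) • q j (n + k) w else 0 := by
      split_ifs with h
      · subst h; push_cast; rw [sub_neg_eq_add]
      · simp
    rw [f1, f2]
    abel
  · intro i _ hij
    simp only [normalOrdered, LinearMap.sub_apply, Module.End.mul_apply, LinearMap.smul_apply,
      Module.End.one_apply, map_sub, map_smul]
    rw [mul_apply_eq hc i j (n - a) k, map_add, mul_apply_eq hc i j a k, map_smul]
    simp [hij]
  · simp

theorem linear_apply_mode
    (hc : ∀ i j n m v, q i n (q j m v) - q j m (q i n v) =
      (if n + m = 0 ∧ i = j then (n : ℚ) else 0) • v)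
    (hS : ∀ n v, (Function.support fun a => modeTerm q n a v).Finite)
    {L : ℤ → Module.End ℚ V} (hL : ∀ n v, L n v = (2⁻¹ : ℚ) • ∑ᶠ a, modeTerm q n a v)
    (n : ℤ) (j : Fin b) (k : ℤ) (w : V) :
    L n (q j k w) = q j k (L n w) + (-k : ℚ) • q j (n + k) w := by
  have hfs : ∀ (x : ℤ) (u : V), (Function.support fun a => if a = x then u else 0).Finite :=
    fun x u => (Set.finite_singleton x).subset fun a ha => by
      by_contra h; exact ha (if_neg h)
  have hsum : ∀ (x : ℤ) (u : V), ∑ᶠ a, (if a = x then u else 0) = u := fun x u => by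
    rw [finsum_eq_single _ x fun a ha => if_neg ha, if_pos rfl]
  have hk : (Function.support fun a => q j k (modeTerm q n a w)).Finite :=
    (hS n w).subset fun a ha h => ha (by simp only at h ⊢; rw [h, map_zero])
  rw [← sub_eq_iff_eq_add', hL, hL, map_smul, ← smul_sub]
  have := (q j k).toAddMonoidHom.map_finsum (hS n w)
  simp only [LinearMap.toAddMonoidHom_coe] at this
  rw [this, ← finsum_sub_distrib (hS n _) hk, finsum_congr (modeTerm_apply_sub hc n · j k w),
    finsum_add_distrib (hfs _ _) (hfs _ _), hsum, hsum, ← two_smul ℚ, smul_smul]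
  norm_num

theorem linear_apply_modeTerm
    {L : ℤ → Module.End ℚ V}
    (hLq : ∀ n j k w, L n (q j k w) = q j k (L n w) + (-k : ℚ) • q j (n + k) w)
    (m n a : ℤ) (v : V) :
    L m (modeTerm q n a v) - modeTerm q n a (L m v) =
      (-a : ℚ) • modeTerm q (m + n) (m + a) v + ((a : ℚ) - n) • modeTerm q (m + n) a v
        - (if m + n = 0 then (b : ℚ) * anomaly m a else 0) • v := by
  have key : ∀ i, L m (normalOrdered q i a (n - a) v) - normalOrdered q i a (n - a) (L m v) =
      (-a : ℚ) • normalOrdered q i (m + a) (m + n - (m + a)) v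
        + ((a : ℚ) - n) • normalOrdered q i a (m + n - a) v
        - (if m + n = 0 then anomaly m a else 0) • v := by
    intro i
    simp only [normalOrdered, LinearMap.sub_apply, Module.End.mul_apply, LinearMap.smul_apply,
      Module.End.one_apply, map_sub, map_smul, hLq, map_add]
    rw [show m + n - (m + a) = n - a by ring, show m + (n - a) = m + n - a by ring,
      show m + a + (n - a) = m + n by ring, show a + (m + n - a) = m + n by ring]
    by_cases h : m + n = 0
    · obtain rfl : n = -m := by omega
      simp only [h, true_and, if_true, anomaly]
      split_ifs <;> push_cast <;> module
    · simp only [h, false_and, if_false]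
      push_cast
      module
  simp only [modeTerm, LinearMap.sum_apply, map_sum, ← Finset.sum_sub_distrib, key]
  rw [Finset.sum_sub_distrib, Finset.sum_add_distrib, ← Finset.smul_sum, ← Finset.smul_sum]
  congr 1
  simp only [Finset.sum_const, Finset.card_univ, Fintype.card_fin]
  rw [← Nat.cast_smul_eq_nsmul ℚ, smul_smul]
  split_ifs <;> simp

theorem linear_commutator
    (hS : ∀ n v, (Function.support fun a => modeTerm q n a v).Finite)
    {L : ℤ → Module.End ℚ V} (hL : ∀ n v, L n v = (2⁻¹ : ℚ) • ∑ᶠ a, modeTerm q n a v)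
    (hLq : ∀ n j k w, L n (q j k w) = q j k (L n w) + (-k : ℚ) • q j (n + k) w)
    (m n : ℤ) (v : V) :
    L m (L n v) - L n (L m v) = ((m : ℚ) - n) • L (m + n) v
      - (if m + n = 0 then (((m : ℚ) ^ 3 - m) / 12) * (b : ℚ) else 0) • v := by
  have hA : (Function.support (anomaly m)).Finite :=
    (Finset.finite_toSet _).subset (support_anomaly_subset m)
  have hsupp : ∀ c : ℤ → ℚ,
      (Function.support fun a => c a • modeTerm q (m + n) a v).Finite := fun c =>
    (hS (m + n) v).subset fun a ha h => ha (by simp only at h ⊢; rw [h, smul_zero])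
  have hshift : (fun a : ℤ => (-a : ℚ) • modeTerm q (m + n) (m + a) v) =
      (fun a : ℤ => ((m : ℚ) - a) • modeTerm q (m + n) a v) ∘ (Equiv.addLeft m) := by
    funext a
    simp only [Function.comp_apply, Equiv.coe_addLeft]
    congr 1
    push_cast
    ring
  have hF1 : (Function.support fun a : ℤ =>
      (-a : ℚ) • modeTerm q (m + n) (m + a) v).Finite := by
    rw [hshift, Function.support_comp_eq_preimage]
    exact (hsupp fun a => (m : ℚ) - a).preimage (Equiv.injective _).injOn
  have hS1 : ∑ᶠ a : ℤ, (-a : ℚ) • modeTerm q (m + n) (m + a) v =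
      ∑ᶠ a : ℤ, ((m : ℚ) - a) • modeTerm q (m + n) a v := by
    rw [hshift]
    exact finsum_comp_equiv (Equiv.addLeft m)
      (f := fun a : ℤ => ((m : ℚ) - a) • modeTerm q (m + n) a v)
  have hF3 : (Function.support fun a : ℤ =>
      (if m + n = 0 then (b : ℚ) * anomaly m a else 0) • v).Finite :=
    hA.subset fun a ha h => ha (by simp only; rw [h]; simp)
  have hS3 : ∑ᶠ a : ℤ, (if m + n = 0 then (b : ℚ) * anomaly m a else 0) • v =
      (if m + n = 0 then (b : ℚ) * (((m : ℚ) ^ 3 - m) / 6) else 0) • v := by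
    split_ifs
    · rw [← finsum_anomaly, ← smul_eq_mul, smul_finsum' _ hA, finsum_smul]
      rfl
    · simp
  have hk : (Function.support fun a => L m (modeTerm q n a v)).Finite :=
    (hS n v).subset fun a ha h => ha (by simp only at h ⊢; rw [h, map_zero])
  have hmap := (L m).toAddMonoidHom.map_finsum (hS n v)
  simp only [LinearMap.toAddMonoidHom_coe] at hmap
  rw [hL n v, map_smul, hL n (L m v), ← smul_sub, hmap, ← finsum_sub_distrib hk (hS n _),
    finsum_congr (linear_apply_modeTerm hLq m n · v),
    finsum_sub_distrib ((hF1.union (hsupp fun a => (a : ℚ) - n)).subset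
      (Function.support_add _ _)) hF3,
    finsum_add_distrib hF1 (hsupp fun a => (a : ℚ) - n), hS1,
    ← finsum_add_distrib (hsupp fun a => (m : ℚ) - a) (hsupp fun a => (a : ℚ) - n), hS3]
  simp only [← add_smul, sub_add_sub_cancel]
  rw [← smul_finsum' _ (hS (m + n) v), hL (m + n) v]
  split_ifs <;> module

end

end Virasoro

open Virasoro in
theorem stmt7 {V : Type*} [AddCommGroup V] [Module ℚ V]
    (b : ℕ) (hb : 1 ≤ b) (q : Fin b → ℤ → Module.End ℚ V)
    (hq : ∀ i j : Fin b, ∀ n m : ℤ, n ≠ 0 → m ≠ 0 →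
      ⁅q i n, q j m⁆ =
        ((n : ℚ) * (if n + m = 0 then 1 else 0) * (if i = j then 1 else 0)) • 1)
    (hq0 : ∀ i, q i 0 = 0)
    (hfin : ∀ v : V, ∃ N : ℤ, ∀ n : ℤ, N < n → ∀ i, q i (-n) v = 0)
    (m n : ℤ) (v : V) :
    Lop b q m (Lop b q n v) - Lop b q n (Lop b q m v) =
      ((m : ℚ) - (n : ℚ)) • Lop b q (m + n) v -
      (if m + n = 0 then (((m : ℚ) ^ 3 - (m : ℚ)) / 12) * (b : ℚ) else 0) • v := by
  have hc := commutator_apply hq hq0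
  have hS := finite_support_modeTerm hc hq0 hfin
  obtain ⟨L, hL⟩ := exists_linear hS
  have hLop : ∀ n v, Lop b q n v = L n v := fun n v => by
    rw [hL, Lop, finsum_congr (summand_eq_modeTerm hc hq0 n · v)]
  simp only [hLop]
  exact linear_commutator hS hL (linear_apply_mode hc hS hL) m n v

end
end

section
/- Let I ⊆ ℂ[x,y] be an ideal containing (x,y)^N for some N ≥ 1, let n = dim_ℂ(ℂ[x,y]/I) and μ = dim_ℂ(I/(m·I)) where m = (x,y) (so μ is the minimal number of generators of I, and μ − 1 = dim_ℂ Hom_{ℂ[x,y]}(I, ℂ[x,y]/m) − 1). Then μ·(μ − 1) ≤ 2n; equivalently, μ − 1 ≤ √(2n + 1/4) − 1/2. -/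
/-!
Statement 12: for an ideal `I ⊆ ℂ[x,y]` containing `(x,y)^N` for some `N ≥ 1`, with
colength `n = dim_ℂ(ℂ[x,y]/I)` and minimal number of generators `μ = dim_ℂ(I/(m·I))`,
one has `μ·(μ-1) ≤ 2n`; equivalently `μ - 1 ≤ √(2n + 1/4) - 1/2`.
-/

noncomputable section

open MvPolynomial

/-- The polynomial ring ℂ[x,y]. -/
abbrev Poly2 : Type := MvPolynomial (Fin 2) ℂ

/-- The maximal ideal `m = (x, y)` of the origin. -/
def mIdeal : Ideal Poly2 := Ideal.span {X 0, X 1}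

/-- The colength `n = dim_ℂ (ℂ[x,y]/I)`. -/
def colength (I : Ideal Poly2) : ℕ := Module.finrank ℂ (Poly2 ⧸ I)

/-- The ℂ-dimension of `I / (m·I)`, i.e. the minimal number of generators of `I`. -/
def mingen (I : Ideal Poly2) : ℕ :=
  Module.finrank ℂ
    (↥(I.restrictScalars ℂ) ⧸
      (Submodule.comap (I.restrictScalars ℂ).subtype
        ((mIdeal * I).restrictScalars ℂ)))

/-- The residue field of the origin is one-dimensional. -/
theorem colength_mIdeal : colength mIdeal = 1 := by
  refine finrank_eq_one (1 : Poly2 ⧸ mIdeal) ?_ ?_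
  · intro h
    have h1 : (1 : Poly2) ∈ mIdeal := Ideal.Quotient.eq_zero_iff_mem.mp (by simpa using h)
    have h2 : mIdeal ≤ RingHom.ker (constantCoeff : Poly2 →+* ℂ) := by
      refine Ideal.span_le.mpr ?_
      rintro p (rfl | rfl) <;> simp
    simpa using h2 h1
  · intro w
    obtain ⟨p, rfl⟩ := Ideal.Quotient.mk_surjective w
    induction p using MvPolynomial.induction_on with
    | C a => exact ⟨a, (Algebra.algebraMap_eq_smul_one a).symm⟩
    | add p q hp hq =>
      obtain ⟨a, ha⟩ := hp
      obtain ⟨b, hb⟩ := hq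
      exact ⟨a + b, by rw [add_smul, ha, hb, map_add]⟩
    | mul_X p i _ =>
      refine ⟨0, ?_⟩
      rw [zero_smul, eq_comm, Ideal.Quotient.eq_zero_iff_mem]
      refine Ideal.mul_mem_left _ _ (Ideal.subset_span ?_)
      fin_cases i <;> simp

theorem finite_quotient_of_pow_mIdeal_le {I : Ideal Poly2} {N : ℕ} (h : mIdeal ^ N ≤ I) :
    Module.Finite ℂ (Poly2 ⧸ I) := by
  have hX : ∀ i : Fin 2, IsIntegral ℂ (Ideal.Quotient.mk I (X i)) := by
    intro i
    have hi : (X i : Poly2) ^ N ∈ I := by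
      refine h (Ideal.pow_mem_pow (Ideal.subset_span ?_) N)
      fin_cases i <;> simp
    refine ⟨Polynomial.X ^ N, Polynomial.monic_X_pow N, ?_⟩
    rw [Polynomial.eval₂_X_pow, ← map_pow]
    exact Ideal.Quotient.eq_zero_iff_mem.mpr hi
  have : Algebra.IsIntegral ℂ (Poly2 ⧸ I) := by
    refine ⟨fun w => ?_⟩
    obtain ⟨p, rfl⟩ := Ideal.Quotient.mk_surjective w
    induction p using MvPolynomial.induction_on with
    | C a => exact isIntegral_algebraMap (R := ℂ) (A := Poly2 ⧸ I) (x := a)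
    | add p q hp hq => rw [map_add]; exact hp.add hq
    | mul_X p i hp => rw [map_mul]; exact hp.mul (hX i)
  exact Algebra.IsIntegral.finite

theorem finite_quotient_of_le {I J : Ideal Poly2} [Module.Finite ℂ (Poly2 ⧸ I)] (h : I ≤ J) :
    Module.Finite ℂ (Poly2 ⧸ J) :=
  Module.Finite.of_surjective (Ideal.Quotient.factorₐ ℂ h).toLinearMap
    (Ideal.Quotient.factor_surjective h)

theorem colength_anti {I J : Ideal Poly2} [Module.Finite ℂ (Poly2 ⧸ I)] (h : I ≤ J) :
    colength J ≤ colength I :=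
  LinearMap.finrank_le_finrank_of_surjective (f := (Ideal.Quotient.factorₐ ℂ h).toLinearMap)
    (Ideal.Quotient.factor_surjective h)

theorem colength_lt {I J : Ideal Poly2} [Module.Finite ℂ (Poly2 ⧸ I)] (h : I < J) :
    colength J < colength I := by
  have := finite_quotient_of_le h.le
  refine lt_of_le_of_ne (colength_anti h.le) fun heq => h.not_ge fun p hp => ?_
  have hinj := (LinearMap.injective_iff_surjective_of_finrank_eq_finrank
    (f := (Ideal.Quotient.factorₐ ℂ h.le).toLinearMap) heq.symm).mpr
    (Ideal.Quotient.factor_surjective h.le)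
  refine Ideal.Quotient.eq_zero_iff_mem.mp (hinj ?_)
  rw [map_zero]
  exact Ideal.Quotient.eq_zero_iff_mem.mpr hp

/-- The ideal quotient `(I : a)`. -/
def quotBy (I : Ideal Poly2) (a : Poly2) : Ideal Poly2 :=
  Submodule.comap (LinearMap.mulLeft Poly2 a) I

theorem mem_quotBy {I : Ideal Poly2} {a p : Poly2} : p ∈ quotBy I a ↔ a * p ∈ I := Iff.rfl

theorem le_quotBy (I : Ideal Poly2) (a : Poly2) : I ≤ quotBy I a :=
  fun _ hp => I.mul_mem_left a hp

theorem colength_eq_add_quotBy (I : Ideal Poly2) (a : Poly2) [Module.Finite ℂ (Poly2 ⧸ I)] :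
    colength I = colength (I ⊔ Ideal.span {a}) + colength (quotBy I a) := by
  let g : (Poly2 ⧸ I) →ₗ[ℂ] Poly2 ⧸ (I ⊔ Ideal.span {a}) :=
    (Ideal.Quotient.factorₐ ℂ le_sup_left).toLinearMap
  have hg : Function.Surjective g := Ideal.Quotient.factor_surjective le_sup_left
  let f : (Poly2 ⧸ quotBy I a) →ₗ[Poly2] Poly2 ⧸ I :=
    Submodule.mapQ _ _ (LinearMap.mulLeft Poly2 a) le_rfl
  have hf : Function.Injective f := by
    refine (injective_iff_map_eq_zero f).mpr fun w hw => ?_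
    obtain ⟨p, rfl⟩ := Ideal.Quotient.mk_surjective w
    have hp : a * p ∈ I := Ideal.Quotient.eq_zero_iff_mem.mp hw
    exact Ideal.Quotient.eq_zero_iff_mem.mpr hp
  have hrange : LinearMap.range (f.restrictScalars ℂ) = LinearMap.ker g := by
    ext w
    obtain ⟨p, rfl⟩ := Ideal.Quotient.mk_surjective w
    have hker : Ideal.Quotient.mk I p ∈ LinearMap.ker g ↔ p ∈ I ⊔ Ideal.span {a} :=
      LinearMap.mem_ker.trans Ideal.Quotient.eq_zero_iff_mem
    rw [hker]
    constructor
    · rintro ⟨q, hq⟩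
      obtain ⟨q, rfl⟩ := Ideal.Quotient.mk_surjective q
      have h1 : a * q - p ∈ I := Ideal.Quotient.eq.mp hq
      have h2 : p = -(a * q - p) + q * a := by ring
      rw [h2]
      exact Submodule.add_mem_sup (I.neg_mem h1)
        (Ideal.mul_mem_left _ _ (Ideal.mem_span_singleton_self a))
    · intro hp
      obtain ⟨u, hu, v, hv, rfl⟩ := Submodule.mem_sup.mp hp
      obtain ⟨q, rfl⟩ := Ideal.mem_span_singleton.mp hv
      refine ⟨Ideal.Quotient.mk _ q, ?_⟩
      refine Ideal.Quotient.eq.mpr ?_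
      have h2 : a * q - (u + a * q) = -u := by ring
      exact h2 ▸ I.neg_mem hu
  have h1 := LinearMap.finrank_range_add_finrank_ker g
  rw [LinearMap.range_eq_top.mpr hg, finrank_top, ← hrange,
    LinearMap.finrank_range_of_inj (f := f.restrictScalars ℂ) hf] at h1
  exact h1.symm

theorem mingen_add_colength (I : Ideal Poly2) [Module.Finite ℂ (Poly2 ⧸ (mIdeal * I))] :
    mingen I + colength I = colength (mIdeal * I) := by
  let g : (Poly2 ⧸ (mIdeal * I)) →ₗ[ℂ] Poly2 ⧸ I :=
    (Ideal.Quotient.factorₐ ℂ Ideal.mul_le_right).toLinearMap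
  have hg : Function.Surjective g := Ideal.Quotient.factor_surjective Ideal.mul_le_right
  let mk : Poly2 →ₗ[ℂ] Poly2 ⧸ (mIdeal * I) := (Ideal.Quotient.mkₐ ℂ (mIdeal * I)).toLinearMap
  have hmk : LinearMap.ker mk = (mIdeal * I).restrictScalars ℂ := by
    ext p
    exact LinearMap.mem_ker.trans Ideal.Quotient.eq_zero_iff_mem
  let f := mk ∘ₗ (I.restrictScalars ℂ).subtype
  have hf : LinearMap.ker f = Submodule.comap (I.restrictScalars ℂ).subtype
      ((mIdeal * I).restrictScalars ℂ) := by
    rw [LinearMap.ker_comp, hmk]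
  have hrange : LinearMap.range f = LinearMap.ker g := by
    ext w
    obtain ⟨p, rfl⟩ := Ideal.Quotient.mk_surjective w
    have hker : Ideal.Quotient.mk (mIdeal * I) p ∈ LinearMap.ker g ↔ p ∈ I :=
      LinearMap.mem_ker.trans Ideal.Quotient.eq_zero_iff_mem
    rw [hker]
    constructor
    · rintro ⟨q, hq⟩
      have h1 : (q : Poly2) - p ∈ mIdeal * I := Ideal.Quotient.eq.mp hq
      exact (I.sub_mem_iff_right q.2).mp (Ideal.mul_le_right h1)
    · exact fun hp => ⟨⟨p, hp⟩, rfl⟩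
  have h1 := LinearMap.finrank_range_add_finrank_ker g
  rw [LinearMap.range_eq_top.mpr hg, finrank_top, ← hrange,
    ← f.quotKerEquivRange.finrank_eq, hf] at h1
  rw [add_comm]
  exact h1

theorem X_zero_mem_mIdeal : (X 0 : Poly2) ∈ mIdeal := Ideal.subset_span (by simp)

theorem X_one_mem_mIdeal : (X 1 : Poly2) ∈ mIdeal := Ideal.subset_span (by simp)

theorem mIdeal_mul_sup_span_X_zero (I : Ideal Poly2) :
    mIdeal * I ⊔ Ideal.span {X 0} = Ideal.span {X 1} * I ⊔ Ideal.span {X 0} := by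
  have h : mIdeal = Ideal.span {X 0} ⊔ Ideal.span {X 1} := Ideal.span_insert _ _
  apply le_antisymm
  · rw [h, Ideal.sup_mul]
    exact sup_le (sup_le (Ideal.mul_le_left.trans le_sup_right) le_sup_left) le_sup_right
  · exact sup_le_sup_right (Ideal.mul_mono_left (h ▸ le_sup_right)) _

/-- Modulo `x`, multiplying an ideal by `m` increases the colength by exactly one. -/
theorem colength_mIdeal_mul_sup (I : Ideal Poly2) [Module.Finite ℂ (Poly2 ⧸ (mIdeal * I))] :
    colength (mIdeal * I ⊔ Ideal.span {X 0}) = colength (I ⊔ Ideal.span {X 0}) + 1 := by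
  have := finite_quotient_of_le (le_sup_left : mIdeal * I ≤ mIdeal * I ⊔ Ideal.span {X 0})
  rw [colength_eq_add_quotBy _ (X 1)]
  have h1 : mIdeal * I ⊔ Ideal.span {X 0} ⊔ Ideal.span {X 1} = mIdeal := by
    rw [sup_assoc, ← Ideal.span_insert]
    exact sup_eq_right.mpr Ideal.mul_le_left
  have h2 : quotBy (mIdeal * I ⊔ Ideal.span {X 0}) (X 1) = I ⊔ Ideal.span {X 0} := by
    ext p
    rw [mem_quotBy]
    constructor
    · rw [mIdeal_mul_sup_span_X_zero]
      intro hp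
      obtain ⟨u, hu, v, hv, huv⟩ := Submodule.mem_sup.mp hp
      obtain ⟨i, hi, rfl⟩ := Ideal.mem_span_singleton_mul.mp hu
      obtain ⟨q, rfl⟩ := Ideal.mem_span_singleton.mp hv
      have h3 : (X 0 : Poly2) ∣ X 1 * (p - i) := ⟨q, by rw [mul_sub, ← huv]; ring⟩
      have h4 : ¬ (X 0 : Poly2) ∣ X 1 := by
        rw [X_dvd_X]
        simp
      have h5 := ((MvPolynomial.X_prime (i := (0 : Fin 2))).dvd_or_dvd h3).resolve_left h4
      have h6 : p = i + (p - i) := by ring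
      rw [h6]
      exact Submodule.add_mem_sup hi (Ideal.mem_span_singleton.mpr h5)
    · intro hp
      obtain ⟨u, hu, v, hv, rfl⟩ := Submodule.mem_sup.mp hp
      rw [mul_add]
      exact Submodule.add_mem_sup (Ideal.mul_mem_mul X_one_mem_mIdeal hu)
        (Ideal.mul_mem_left _ _ hv)
  rw [h1, h2, colength_mIdeal, add_comm]

theorem mIdeal_mul_quotBy_le (I : Ideal Poly2) :
    mIdeal * quotBy I (X 0) ≤ quotBy (mIdeal * I) (X 0) := by
  refine Ideal.mul_le.mpr fun r hr s hs => ?_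
  rw [mem_quotBy, mul_left_comm]
  exact Ideal.mul_mem_mul hr hs

theorem le_quotBy_mIdeal_mul (I : Ideal Poly2) : I ≤ quotBy (mIdeal * I) (X 0) :=
  fun _ hp => Ideal.mul_mem_mul X_zero_mem_mIdeal hp

/-- Induction on the power of `x` contained in `I`, passing from `I` to `(I : x)`. -/
theorem mingen_bounds {M : ℕ} (N : ℕ) (I : Ideal Poly2) (hM : mIdeal ^ M ≤ I)
    (hN : (X 0 : Poly2) ^ N ∈ I) :
    mingen I ≤ colength (I ⊔ Ideal.span {X 0}) + 1 ∧
      mingen I * (mingen I - 1) ≤ 2 * colength I := by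
  induction N generalizing I with
  | zero =>
    obtain rfl : I = ⊤ := (Ideal.eq_top_iff_one I).mpr (by simpa using hN)
    have hfin : Module.Finite ℂ (Poly2 ⧸ (mIdeal * ⊤)) :=
      finite_quotient_of_pow_mIdeal_le (N := 1) (by simp)
    have h := mingen_add_colength ⊤
    rw [Ideal.mul_top, colength_mIdeal] at h
    have h1 : mingen ⊤ ≤ 1 := by omega
    refine ⟨by omega, ?_⟩
    rw [Nat.sub_eq_zero_of_le h1]
    simp
  | succ N ih =>
    have hM' : mIdeal ^ M ≤ quotBy I (X 0) := hM.trans (le_quotBy I _)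
    have hfin {J : Ideal Poly2} (hJ : mIdeal ^ M ≤ J) : Module.Finite ℂ (Poly2 ⧸ (mIdeal * J)) :=
      finite_quotient_of_pow_mIdeal_le (N := M + 1) (by rw [pow_succ']; exact Ideal.mul_mono_right hJ)
    have := hfin hM
    have := hfin hM'
    have := finite_quotient_of_pow_mIdeal_le hM
    obtain ⟨ih1, ih2⟩ := ih (quotBy I (X 0)) hM' (by rw [mem_quotBy, ← pow_succ']; exact hN)
    have e1 := mingen_add_colength I
    have e2 := mingen_add_colength (quotBy I (X 0))
    have e3 := colength_eq_add_quotBy I (X 0)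
    have e4 := colength_eq_add_quotBy (mIdeal * I) (X 0)
    have e5 := colength_mIdeal_mul_sup I
    have e6 := colength_mIdeal_mul_sup (quotBy I (X 0))
    have e7 := colength_anti (mIdeal_mul_quotBy_le I)
    have := finite_quotient_of_le (le_sup_left : I ≤ I ⊔ Ideal.span {X 0})
    have e8 := colength_anti (sup_le_sup_right (le_quotBy I (X 0)) (Ideal.span {X 0}))
    by_cases hle : I ≤ mIdeal * quotBy I (X 0)
    · have e9 := colength_anti (sup_le_sup_right hle (Ideal.span {X 0}))
      refine ⟨by omega, ?_⟩
      calc mingen I * (mingen I - 1)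
          ≤ (mingen (quotBy I (X 0)) + 1) * mingen (quotBy I (X 0)) :=
            Nat.mul_le_mul (by omega) (by omega)
        _ = mingen (quotBy I (X 0)) * (mingen (quotBy I (X 0)) - 1)
              + 2 * mingen (quotBy I (X 0)) := by
            cases mingen (quotBy I (X 0)) with
            | zero => rfl
            | succ k => rw [Nat.add_sub_cancel]; ring
        _ ≤ 2 * colength I := by omega
    · have e9 := colength_lt (lt_of_le_of_ne (mIdeal_mul_quotBy_le I)
        fun heq => hle (heq ▸ le_quotBy_mIdeal_mul I))
      refine ⟨by omega, ?_⟩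
      calc mingen I * (mingen I - 1)
          ≤ mingen (quotBy I (X 0)) * (mingen (quotBy I (X 0)) - 1) :=
            Nat.mul_le_mul (by omega) (by omega)
        _ ≤ 2 * colength I := by omega

theorem stmt12 (I : Ideal Poly2)
    (hI : ∃ N : ℕ, 1 ≤ N ∧ mIdeal ^ N ≤ I) :
    mingen I * (mingen I - 1) ≤ 2 * colength I ∧
    (mingen I : ℝ) - 1 ≤ Real.sqrt (2 * colength I + 1 / 4) - 1 / 2 := by
  obtain ⟨N, -, hN⟩ := hI
  have h := (mingen_bounds N I hN (hN (Ideal.pow_mem_pow X_zero_mem_mIdeal N))).2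
  refine ⟨h, ?_⟩
  have hR : (mingen I : ℝ) * (mingen I - 1) ≤ 2 * colength I := by
    rcases Nat.eq_zero_or_pos (mingen I) with h0 | h0
    · rw [h0]
      simp
    · rw [← Nat.cast_pred h0]
      exact_mod_cast h
  have hs : (mingen I : ℝ) - 1 / 2 ≤ Real.sqrt (2 * colength I + 1 / 4) :=
    Real.le_sqrt_of_sq_le (by linarith)
  linarith

end
end

section
/- Let I ⊆ ℂ[x,y] be an ideal containing (x,y)^N for some N ≥ 1, let n = dim_ℂ(ℂ[x,y]/I), m = (x,y), and μ = dim_ℂ(I/(m·I)). If n = 1 or n = 2, then μ = 2. If n = 3, then μ ∈ {2, 3}, and μ = 3 if and only if I = m². -/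
/-!
Statement 13: for an ideal `I ⊆ ℂ[x,y]` containing `(x,y)^N` for some `N ≥ 1`, with
colength `n = dim_ℂ(ℂ[x,y]/I)` and minimal number of generators `μ = dim_ℂ(I/(m·I))`:
if `n = 1` or `n = 2` then `μ = 2`; if `n = 3` then `μ ∈ {2, 3}` and `μ = 3 ↔ I = m²`.
-/

noncomputable section

open MvPolynomial

theorem mIdeal_eq_idealOfVars : mIdeal = idealOfVars (Fin 2) ℂ := by
  rw [mIdeal, idealOfVars]
  congr 1
  ext p
  simp [eq_comm]

theorem mem_mIdeal_iff {p : Poly2} : p ∈ mIdeal ↔ constantCoeff p = 0 := by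
  rw [mIdeal_eq_idealOfVars, ← pow_one (idealOfVars _ _), mem_pow_idealOfVars_iff']
  simp [constantCoeff_eq, Finsupp.degree_eq_zero_iff]

theorem sub_C_constantCoeff_mem_mIdeal (p : Poly2) : p - C (constantCoeff p) ∈ mIdeal := by
  simp [mem_mIdeal_iff]

theorem mIdeal_isMaximal : mIdeal.IsMaximal := by
  have h : mIdeal = RingHom.ker (constantCoeff : Poly2 →+* ℂ) := by
    ext p
    rw [mem_mIdeal_iff, RingHom.mem_ker]
  rw [h]
  exact RingHom.ker_isMaximal_of_surjective _ fun c => ⟨C c, constantCoeff_C _ c⟩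

theorem exists_mul_sub_one_mem_mIdeal_pow {p : Poly2} (hp : p ∉ mIdeal) (N : ℕ) :
    ∃ r, r * p - 1 ∈ mIdeal ^ N := by
  have h : Ideal.span {p} ⊔ mIdeal = ⊤ := by
    rw [sup_comm]
    exact mIdeal_isMaximal.1.2 _ (left_lt_sup.2 fun h => hp (h (Ideal.mem_span_singleton_self p)))
  have h1 := (Ideal.eq_top_iff_one _).1 (Ideal.sup_pow_eq_top (n := N) h)
  obtain ⟨a, ha, b, hb, hab⟩ := Submodule.mem_sup.1 h1
  obtain ⟨r, rfl⟩ := Ideal.mem_span_singleton'.1 ha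
  refine ⟨r, ?_⟩
  rw [← hab]
  simpa using hb

theorem le_mIdeal_of_pow_le {I : Ideal Poly2} {N : ℕ} (hN : mIdeal ^ N ≤ I) (hI : I ≠ ⊤) :
    I ≤ mIdeal := by
  obtain ⟨M, hM, hIM⟩ := Ideal.exists_le_maximal I hI
  have h : mIdeal ≤ M := hM.isPrime.le_of_pow_le (hN.trans hIM)
  rwa [mIdeal_isMaximal.eq_of_le hM.ne_top h]

/-- If all syzygies between generators of `I` have coefficients in `m`, then the generators
form a basis of `I / (m·I)`. -/
theorem mingen_eq_of_syzygies {I : Ideal Poly2} {k : ℕ} (g : Fin k → Poly2)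
    (hspan : Ideal.span (Set.range g) = I)
    (hsyz : ∀ c : Fin k → Poly2, ∑ i, c i * g i = 0 → ∀ i, c i ∈ mIdeal) :
    mingen I = k := by
  have hg : ∀ i, g i ∈ I := fun i => hspan ▸ Ideal.subset_span ⟨i, rfl⟩
  have hmem : ∀ p : Poly2, p ∈ mIdeal * I ↔
      ∃ d : Fin k → Poly2, (∀ i, d i ∈ mIdeal) ∧ ∑ i, d i * g i = p := by
    intro p
    rw [← hspan, ← smul_eq_mul, Ideal.span, Submodule.mem_ideal_smul_span_iff_exists_sum]
    constructor
    · rintro ⟨a, ha, h⟩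
      refine ⟨a, ha, ?_⟩
      rw [← h, Finsupp.sum_fintype _ _ (by simp)]
      simp
    · rintro ⟨d, hd, h⟩
      refine ⟨Finsupp.equivFunOnFinite.symm d, hd, ?_⟩
      rw [← h, Finsupp.sum_fintype _ _ (by simp)]
      simp
  let L : (Fin k → ℂ) →ₗ[ℂ] I.restrictScalars ℂ :=
    Fintype.linearCombination ℂ fun i => (⟨g i, hg i⟩ : I.restrictScalars ℂ)
  have hL : ∀ c, (L c : Poly2) = ∑ i, C (c i) * g i := by
    intro c
    simp [L, Fintype.linearCombination_apply, C_mul']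
  let S := Submodule.comap (I.restrictScalars ℂ).subtype ((mIdeal * I).restrictScalars ℂ)
  have hbij : Function.Bijective (S.mkQ ∘ₗ L) := by
    constructor
    · rw [← LinearMap.ker_eq_bot, LinearMap.ker_eq_bot']
      intro c hc
      have h1 : (L c : Poly2) ∈ mIdeal * I := (Submodule.Quotient.mk_eq_zero S).1 hc
      rw [hL, hmem] at h1
      obtain ⟨d, hd, hdc⟩ := h1
      have h2 := hsyz (fun i => C (c i) - d i) (by
        simp only [sub_mul, Finset.sum_sub_distrib, hdc, sub_self])
      ext i
      have h3 := (mem_mIdeal_iff.1 (add_mem (h2 i) (hd i)))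
      simpa using h3
    · intro q
      obtain ⟨⟨p, hp⟩, rfl⟩ := S.mkQ_surjective q
      have hp' : p ∈ Ideal.span (Set.range g) := by
        rw [hspan]
        exact hp
      obtain ⟨r, hr⟩ := (Ideal.mem_span_range_iff_exists_fun).1 hp'
      refine ⟨fun i => constantCoeff (r i), ?_⟩
      rw [LinearMap.comp_apply, ← sub_eq_zero, ← map_sub, Submodule.mkQ_apply,
        Submodule.Quotient.mk_eq_zero, ← Submodule.neg_mem_iff]
      change -((L _ : Poly2) - p) ∈ mIdeal * I
      rw [hL, hmem]
      refine ⟨fun i => r i - C (constantCoeff (r i)),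
        fun i => sub_C_constantCoeff_mem_mIdeal _, ?_⟩
      simp only [sub_mul, Finset.sum_sub_distrib, hr, neg_sub]
  change Module.finrank ℂ (_ ⧸ S) = k
  rw [← (LinearEquiv.ofBijective _ hbij).finrank_eq, Module.finrank_fin_fun]

theorem mem_mIdeal_of_dvd {p q : Poly2} (hp : p ∈ mIdeal) (h : p ∣ q) : q ∈ mIdeal :=
  Ideal.mem_of_dvd _ h hp

theorem mingen_span_pair {f g : Poly2} (hf : f ∈ mIdeal) (hg : g ∈ mIdeal)
    (hfg : IsRelPrime f g) : mingen (Ideal.span {f, g}) = 2 := by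
  refine mingen_eq_of_syzygies ![f, g] (by simp [Set.pair_comm]) fun c hc => ?_
  simp only [Fin.sum_univ_two, Matrix.cons_val_zero, Matrix.cons_val_one] at hc
  have h0 : g ∣ c 0 := hfg.symm.dvd_of_dvd_mul_right ⟨-c 1, by linear_combination hc⟩
  have h1 : f ∣ c 1 := hfg.dvd_of_dvd_mul_right ⟨-c 0, by linear_combination hc⟩
  rw [Fin.forall_fin_two]
  exact ⟨mem_mIdeal_of_dvd hg h0, mem_mIdeal_of_dvd hf h1⟩

theorem isRelPrime_X_X : IsRelPrime (X 0 : Poly2) (X 1) := by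
  refine X_prime.irreducible.isRelPrime_iff_not_dvd.2 ?_
  simp [X_dvd_X]

theorem isRelPrime_of_span_pair_eq_mIdeal {f v : Poly2} (h : Ideal.span {f, v} = mIdeal) :
    IsRelPrime f v := by
  intro d hf hv
  have hd : mIdeal ≤ Ideal.span {d} := by
    rw [← h, Ideal.span_le]
    rintro p (rfl | rfl)
    exacts [Ideal.mem_span_singleton.2 hf, Ideal.mem_span_singleton.2 hv]
  exact isRelPrime_X_X
    (Ideal.mem_span_singleton.1 (hd (Ideal.subset_span (by simp))))
    (Ideal.mem_span_singleton.1 (hd (Ideal.subset_span (by simp))))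

theorem mingen_eq_two_of_span_pair_eq_mIdeal {I : Ideal Poly2} {N : ℕ} (hN : mIdeal ^ N ≤ I)
    (hI : I ≠ ⊤) {f v : Poly2} (hfI : f ∈ I) (h : Ideal.span {f, v} = mIdeal) :
    mingen I = 2 := by
  classical
  have hf : f ∈ mIdeal := h ▸ Ideal.subset_span (by simp)
  have hv : v ∈ mIdeal := h ▸ Ideal.subset_span (by simp)
  have hex : ∃ k, v ^ k ∈ I := ⟨N, hN (Ideal.pow_mem_pow hv N)⟩
  set k := Nat.find hex with hk
  have hkI : v ^ k ∈ I := Nat.find_spec hex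
  have hk0 : k ≠ 0 := by
    intro h0
    rw [h0, pow_zero] at hkI
    exact hI ((Ideal.eq_top_iff_one _).2 hkI)
  have hle : ∀ j ≤ k, I ≤ Ideal.span {f, v ^ j} := by
    intro j
    induction j with
    | zero =>
      intro _ p _
      exact Ideal.mem_span_pair.2 ⟨0, p, by simp⟩
    | succ j ih =>
      intro hj p hp
      obtain ⟨a, b, rfl⟩ := Ideal.mem_span_pair.1 (ih (by lia) hp)
      have hbv : b * v ^ j ∈ I := (I.add_mem_iff_right (I.mul_mem_left a hfI)).1 hp
      have hb : b ∈ mIdeal := by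
        by_contra hb
        obtain ⟨r, hr⟩ := exists_mul_sub_one_mem_mIdeal_pow hb N
        refine Nat.find_min hex (m := j) (by lia) ?_
        have h1 := I.sub_mem (I.mul_mem_left r hbv) (I.mul_mem_right (v ^ j) (hN hr))
        convert h1 using 1
        ring
      rw [← h] at hb
      obtain ⟨c, d, rfl⟩ := Ideal.mem_span_pair.1 hb
      exact Ideal.mem_span_pair.2 ⟨a + c * v ^ j, d, by ring⟩
  have hIeq : I = Ideal.span {f, v ^ k} := by
    refine le_antisymm (hle k le_rfl) ?_
    rw [Ideal.span_le]
    rintro p (rfl | rfl)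
    exacts [hfI, hkI]
  rw [hIeq]
  exact mingen_span_pair hf (Ideal.pow_mem_of_mem _ hv k (Nat.pos_of_ne_zero hk0))
    (isRelPrime_of_span_pair_eq_mIdeal h).pow_right

theorem exists_span_pair_eq_mIdeal {I : Ideal Poly2} {N : ℕ} (hN : mIdeal ^ N ≤ I)
    {u v a b : Poly2} (huv : Ideal.span {u, v} = mIdeal) (hf : a * u + b * v ∈ I)
    (ha : a ∉ mIdeal) : ∃ f ∈ I, Ideal.span {f, v} = mIdeal := by
  obtain ⟨r, hr⟩ := exists_mul_sub_one_mem_mIdeal_pow ha N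
  refine ⟨u + v * (r * b), ?_, ?_⟩
  · have h := I.sub_mem (I.mul_mem_left r hf) (I.mul_mem_right u (hN hr))
    convert h using 1
    ring
  · rw [← huv, Ideal.span_pair_add_right_mul]

theorem mingen_eq_two_of_not_le_sq {I : Ideal Poly2} {N : ℕ} (hN : mIdeal ^ N ≤ I)
    (hI : I ≠ ⊤) (hsq : ¬ I ≤ mIdeal ^ 2) : mingen I = 2 := by
  obtain ⟨p, hpI, hp⟩ := SetLike.not_le_iff_exists.1 hsq
  obtain ⟨a, b, rfl⟩ := Ideal.mem_span_pair.1 (le_mIdeal_of_pow_le hN hI hpI)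
  have hX0 : (X 0 : Poly2) ∈ mIdeal := Ideal.subset_span (by simp)
  have hX1 : (X 1 : Poly2) ∈ mIdeal := Ideal.subset_span (by simp)
  by_cases ha : a ∈ mIdeal
  · have hb : b ∉ mIdeal := fun hb => hp (by
      rw [pow_two]
      exact add_mem (Ideal.mul_mem_mul ha hX0) (Ideal.mul_mem_mul hb hX1))
    obtain ⟨f, hfI, hf⟩ := exists_span_pair_eq_mIdeal hN
      (show Ideal.span {X 1, X 0} = mIdeal by rw [mIdeal, Set.pair_comm])
      (by rwa [add_comm] at hpI) hb
    exact mingen_eq_two_of_span_pair_eq_mIdeal hN hI hfI hf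
  · obtain ⟨f, hfI, hf⟩ := exists_span_pair_eq_mIdeal hN rfl hpI ha
    exact mingen_eq_two_of_span_pair_eq_mIdeal hN hI hfI hf

theorem mingen_mIdeal_sq : mingen (mIdeal ^ 2) = 3 := by
  have hX0 : (X 0 : Poly2) ∈ mIdeal := Ideal.subset_span (by simp)
  have hX1 : (X 1 : Poly2) ∈ mIdeal := Ideal.subset_span (by simp)
  refine mingen_eq_of_syzygies ![X 0 * X 0, X 0 * X 1, X 1 * X 1] ?_ fun c hc => ?_
  · rw [mIdeal, pow_two, Ideal.span_pair_mul_span_pair]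
    congr 1
    ext p
    simp only [mul_comm (X 1 : Poly2) (X 0), Set.mem_insert_iff, Set.mem_singleton_iff,
      Matrix.range_cons, Matrix.range_empty, Set.mem_union, Set.mem_empty_iff_false]
    tauto
  · simp only [Fin.sum_univ_three, Matrix.cons_val] at hc
    obtain ⟨a, ha⟩ : X 1 ∣ c 0 :=
      (isRelPrime_X_X.symm.mul_right isRelPrime_X_X.symm).dvd_of_dvd_mul_right
        ⟨-(c 1 * X 0 + c 2 * X 1), by linear_combination hc⟩
    obtain ⟨b, hb⟩ : X 0 ∣ c 2 :=
      (isRelPrime_X_X.mul_right isRelPrime_X_X).dvd_of_dvd_mul_right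
        ⟨-(c 1 * X 1 + c 0 * X 0), by linear_combination hc⟩
    have h1 : X 0 * X 1 * (a * X 0 + c 1 + b * X 1) = 0 := by
      rw [ha, hb] at hc
      linear_combination hc
    have h2 := (mul_eq_zero.1 h1).resolve_left (mul_ne_zero (X_ne_zero 0) (X_ne_zero 1))
    have h3 : c 1 = -(a * X 0 + b * X 1) := by linear_combination h2
    intro i
    fin_cases i
    · exact mem_mIdeal_of_dvd hX1 ⟨a, ha⟩
    · change c 1 ∈ mIdeal
      rw [h3]
      exact neg_mem (add_mem (Ideal.mul_mem_left _ _ hX0) (Ideal.mul_mem_left _ _ hX1))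
    · exact mem_mIdeal_of_dvd hX0 ⟨b, hb⟩

/-- The `1`-jet at the origin: the coefficients of `1`, `x` and `y`. -/
def oneJet : Poly2 →ₗ[ℂ] Fin 3 → ℂ :=
  LinearMap.pi ![lcoeff ℂ 0, lcoeff ℂ (Finsupp.single 0 1), lcoeff ℂ (Finsupp.single 1 1)]

theorem oneJet_surjective : Function.Surjective oneJet := by
  intro c
  refine ⟨C (c 0) + C (c 1) * X 0 + C (c 2) * X 1, ?_⟩
  ext i
  fin_cases i <;> simp [oneJet, coeff_C_mul, coeff_X, coeff_C, Finsupp.single_left_inj,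
    eq_comm (a := (0 : Fin 2 →₀ ℕ))]

theorem mIdeal_sq_le_ker_oneJet : (mIdeal ^ 2).restrictScalars ℂ ≤ LinearMap.ker oneJet := by
  intro p hp
  rw [Submodule.restrictScalars_mem, mIdeal_eq_idealOfVars, mem_pow_idealOfVars_iff'] at hp
  rw [LinearMap.mem_ker]
  ext i
  fin_cases i <;> simp [oneJet] <;> exact hp _ (by simp)

theorem colength_eq_three_and_eq_of_le_sq {I : Ideal Poly2} (hI : I ≤ mIdeal ^ 2)
    (h0 : 0 < colength I) (h3 : colength I ≤ 3) : colength I = 3 ∧ I = mIdeal ^ 2 := by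
  have : Module.Finite ℂ (Poly2 ⧸ I) := Module.finite_of_finrank_pos h0
  have hker : I.restrictScalars ℂ ≤ LinearMap.ker oneJet :=
    fun p hp => mIdeal_sq_le_ker_oneJet (hI hp)
  let φ : (Poly2 ⧸ I) →ₗ[ℂ] Fin 3 → ℂ := (I.restrictScalars ℂ).liftQ oneJet hker
  have hφ : Function.Surjective φ := fun c => by
    obtain ⟨p, rfl⟩ := oneJet_surjective c
    exact ⟨Ideal.Quotient.mk I p, rfl⟩
  have hle := LinearMap.finrank_le_finrank_of_surjective hφ
  rw [Module.finrank_fin_fun] at hle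
  have heq : colength I = 3 := le_antisymm h3 hle
  have hinj : Function.Injective φ :=
    (LinearMap.injective_iff_surjective_of_finrank_eq_finrank
      (by rw [Module.finrank_fin_fun]; exact heq)).2 hφ
  refine ⟨heq, le_antisymm hI fun p hp => ?_⟩
  rw [← Ideal.Quotient.eq_zero_iff_mem]
  refine hinj ?_
  rw [map_zero]
  exact mIdeal_sq_le_ker_oneJet hp

theorem stmt13 (I : Ideal Poly2)
    (hI : ∃ N : ℕ, 1 ≤ N ∧ mIdeal ^ N ≤ I) :
    (colength I = 1 ∨ colength I = 2 → mingen I = 2) ∧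
    (colength I = 3 →
      (mingen I = 2 ∨ mingen I = 3) ∧ (mingen I = 3 ↔ I = mIdeal ^ 2)) := by
  obtain ⟨N, -, hN⟩ := hI
  have key : 0 < colength I → colength I ≤ 3 →
      mingen I = 2 ∧ I ≠ mIdeal ^ 2 ∨ colength I = 3 ∧ mingen I = 3 ∧ I = mIdeal ^ 2 := by
    intro h0 h3
    by_cases hsq : I ≤ mIdeal ^ 2
    · obtain ⟨h, hIsq⟩ := colength_eq_three_and_eq_of_le_sq hsq h0 h3
      exact Or.inr ⟨h, hIsq ▸ mingen_mIdeal_sq, hIsq⟩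
    · have hI : I ≠ ⊤ := by
        intro hI
        have : Subsingleton (Poly2 ⧸ I) := Ideal.Quotient.subsingleton_iff.2 hI
        exact h0.ne' Module.finrank_zero_of_subsingleton
      exact Or.inl ⟨mingen_eq_two_of_not_le_sq hN hI hsq, fun h => hsq h.le⟩
  refine ⟨fun h => ?_, fun h => ?_⟩
  · rcases key (by lia) (by lia) with h' | h'
    · exact h'.1
    · lia
  · rcases key (by lia) (by lia) with h' | h'
    · exact ⟨Or.inl h'.1, by simp [h'.1, h'.2]⟩
    · exact ⟨Or.inr h'.2.1, iff_of_true h'.2.1 h'.2.2⟩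

end
end
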